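/- For every integer d ≥ 2 and all integers n, k, j with 2 ≤ k ≤ n, j ≥ 1, and either (n ≥ 2k and j < k) or (n < 2k and j < n − k), there exists a point set P ⊆ [0,1]^d with |P| = n and a subset Q ⊆ P with |Q| = k such that Q is a local minimum for j-swaps of the star discrepancy subset selection problem with parameter k on P but Q is not a global minimum: there exists Q' ⊆ P with |Q'| = k and d*∞(Q') < d*∞(Q). -/

import Mathlib

open scoped Classical

noncomputable section

/-- The volume (Lebesgue measure) of the anchored box `[0, q)` (equivalently `[0,q]`). -/
def vol {d : ℕ} (q : Fin d → ℝ) : ℝ := ∏ j, q j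

/-- `x` lies in the open anchored box `[0, q) = ∏_j [0, q_j)`. -/
def inOpenBox {d : ℕ} (q x : Fin d → ℝ) : Prop := ∀ j, 0 ≤ x j ∧ x j < q j

/-- `x` lies in the closed anchored box `[0, q] = ∏_j [0, q_j]`. -/
def inClosedBox {d : ℕ} (q x : Fin d → ℝ) : Prop := ∀ j, 0 ≤ x j ∧ x j ≤ q j

/-- `δ(q, P) = λ(q) - D(q, P) / |P|`, using the open box `[0, q)`. -/
def delta {d : ℕ} (q : Fin d → ℝ) (P : Finset (Fin d → ℝ)) : ℝ :=
  vol q - ((P.filter (fun x => inOpenBox q x)).card : ℝ) / (P.card : ℝ)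

/-- `δ̄(q, P) = D̄(q, P) / |P| - λ(q)`, using the closed box `[0, q]`. -/
def deltaBar {d : ℕ} (q : Fin d → ℝ) (P : Finset (Fin d → ℝ)) : ℝ :=
  ((P.filter (fun x => inClosedBox q x)).card : ℝ) / (P.card : ℝ) - vol q

/-- The `L∞` star discrepancy `d*∞(P) = sup_{q ∈ [0,1]^d} max (δ(q,P)) (δ̄(q,P))`. -/
def starDisc {d : ℕ} (P : Finset (Fin d → ℝ)) : ℝ :=
  sSup {x : ℝ | ∃ q : Fin d → ℝ,
    (∀ j, 0 ≤ q j ∧ q j ≤ 1) ∧ x = max (delta q P) (deltaBar q P)}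

lemma vol_nonneg {d : ℕ} {q : Fin d → ℝ} (hq : ∀ i, 0 ≤ q i ∧ q i ≤ 1) : 0 ≤ vol q :=
  Finset.prod_nonneg fun i _ => (hq i).1

lemma vol_le_one {d : ℕ} {q : Fin d → ℝ} (hq : ∀ i, 0 ≤ q i ∧ q i ≤ 1) : vol q ≤ 1 :=
  Finset.prod_le_one (fun i _ => (hq i).1) fun i _ => (hq i).2

lemma delta_le_one {d : ℕ} {q : Fin d → ℝ} (hq : ∀ i, 0 ≤ q i ∧ q i ≤ 1)
    (S : Finset (Fin d → ℝ)) : delta q S ≤ 1 :=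
  (sub_le_self _ (by positivity)).trans (vol_le_one hq)

lemma card_filter_div_card_le_one {α : Type*} (S : Finset α) (p : α → Prop) :
    ((S.filter p).card : ℝ) / (S.card : ℝ) ≤ 1 :=
  div_le_one_of_le₀ (by exact_mod_cast Finset.card_filter_le _ _) (by positivity)

lemma deltaBar_le_one_sub_vol {d : ℕ} (q : Fin d → ℝ) (S : Finset (Fin d → ℝ)) :
    deltaBar q S ≤ 1 - vol q :=
  sub_le_sub_right (card_filter_div_card_le_one _ _) _

lemma le_starDisc {d : ℕ} {q : Fin d → ℝ} (hq : ∀ i, 0 ≤ q i ∧ q i ≤ 1)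
    (S : Finset (Fin d → ℝ)) : delta q S ≤ starDisc S := by
  refine (le_max_left _ (deltaBar q S)).trans (le_csSup ⟨1, ?_⟩ ⟨q, hq, rfl⟩)
  rintro _ ⟨q', hq', rfl⟩
  exact max_le (delta_le_one hq' S)
    ((deltaBar_le_one_sub_vol q' S).trans (sub_le_self _ (vol_nonneg hq')))

/-- The volume of an open anchored box without points of `S` bounds the discrepancy from below. -/
lemma vol_le_starDisc_of_empty {d : ℕ} {q : Fin d → ℝ} (hq : ∀ i, 0 ≤ q i ∧ q i ≤ 1)
    {S : Finset (Fin d → ℝ)} (hS : ∀ p ∈ S, ¬ inOpenBox q p) : vol q ≤ starDisc S := by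
  have h := le_starDisc hq S
  rwa [delta, Finset.filter_false_of_mem hS, Finset.card_empty, Nat.cast_zero, zero_div,
    sub_zero] at h

/-- If all coordinates of the points of `S` are at least `c`, and `B` is at least
`max (1 - 1 / |S|) (1 - c ^ d)`, then only empty open boxes can push the discrepancy above `B`. -/
lemma starDisc_le {d : ℕ} {S : Finset (Fin d → ℝ)} {c B : ℝ} (hS : S.Nonempty) (hc : 0 ≤ c)
    (hcS : ∀ p ∈ S, ∀ i, c ≤ p i) (h_card : 1 - 1 / (S.card : ℝ) ≤ B) (h_vol : 1 - c ^ d ≤ B)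
    (h_empty : ∀ q : Fin d → ℝ, (∀ i, 0 ≤ q i ∧ q i ≤ 1) → (∀ p ∈ S, ¬ inOpenBox q p) →
      vol q ≤ B) : starDisc S ≤ B := by
  have hpos : (1 : ℝ) ≤ S.card := by exact_mod_cast hS.card_pos
  have hB : 0 ≤ B := le_trans (sub_nonneg.2 ((div_le_one (by linarith)).2 hpos)) h_card
  refine csSup_le ⟨_, fun _ => 0, fun _ => ⟨le_rfl, zero_le_one⟩, rfl⟩ ?_
  rintro _ ⟨q, hq, rfl⟩
  apply max_le
  · by_cases h : ∀ p ∈ S, ¬ inOpenBox q p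
    · exact (sub_le_self _ (by positivity)).trans (h_empty q hq h)
    · push Not at h
      obtain ⟨p, hp, hpq⟩ := h
      have h1 : (1 : ℝ) ≤ (S.filter fun x => inOpenBox q x).card := by
        exact_mod_cast Finset.card_pos.2 ⟨p, Finset.mem_filter.2 ⟨hp, hpq⟩⟩
      exact (sub_le_sub (vol_le_one hq)
        (div_le_div_of_nonneg_right h1 (by linarith))).trans h_card
  · by_cases h : ∀ p ∈ S, ¬ inClosedBox q p
    · rw [deltaBar, Finset.filter_false_of_mem h, Finset.card_empty, Nat.cast_zero, zero_div,
        zero_sub]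
      linarith [vol_nonneg hq]
    · push Not at h
      obtain ⟨p, hp, hpq⟩ := h
      have h1 : c ^ d ≤ vol q := by
        have := Finset.prod_le_prod (s := Finset.univ) (f := fun _ : Fin d => c) (g := q)
          (fun _ _ => hc) fun i _ => (hcS p hp i).trans (hpq i).2
        simpa [vol] using this
      linarith [deltaBar_le_one_sub_vol q S]

/-- The point `(a, b, z, …, z)`. -/
def planarPoint {e : ℕ} (a b z : ℝ) : Fin (e + 2) → ℝ := Fin.cons a (Fin.cons b fun _ => z)

lemma forall_planarPoint {e : ℕ} {a b z : ℝ} {r : ℝ → Prop} (ha : r a) (hb : r b) (hz : r z)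
    (i : Fin (e + 2)) : r (planarPoint a b z i) := by
  refine Fin.cases ha (fun i => Fin.cases hb (fun _ => hz) i) i

lemma inOpenBox_planarPoint {e : ℕ} {a b z : ℝ} (ha : 0 ≤ a) (hb : 0 ≤ b) (hz : 0 ≤ z)
    {q : Fin (e + 2) → ℝ} :
    inOpenBox q (planarPoint a b z) ↔ a < q 0 ∧ b < q 1 ∧ ∀ i : Fin e, z < q i.succ.succ := by
  simp [inOpenBox, planarPoint, Fin.forall_fin_succ, ha, hb, hz]

lemma vol_planarPoint_one {e : ℕ} (a b : ℝ) :
    vol (planarPoint a b 1 : Fin (e + 2) → ℝ) = a * b := by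
  simp [vol, planarPoint, Fin.prod_univ_succ]

lemma vol_le_mul {e : ℕ} {q : Fin (e + 2) → ℝ} (hq : ∀ i, 0 ≤ q i ∧ q i ≤ 1) :
    vol q ≤ q 0 * q 1 := by
  have h : ∏ i : Fin e, q i.succ.succ ≤ 1 :=
    Finset.prod_le_one (fun i _ => (hq _).1) fun i _ => (hq _).2
  have h' := mul_le_mul_of_nonneg_left h (mul_nonneg (hq 0).1 (hq 1).1)
  rw [vol, Fin.prod_univ_succ, Fin.prod_univ_succ, ← mul_assoc]
  simpa using h'

lemma vol_le_apply {d : ℕ} {q : Fin d → ℝ} (hq : ∀ i, 0 ≤ q i ∧ q i ≤ 1) (i : Fin d) :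
    vol q ≤ q i := by
  rw [vol, ← Finset.mul_prod_erase _ _ (Finset.mem_univ i)]
  exact mul_le_of_le_one_right (hq i).1
    (Finset.prod_le_one (fun i _ => (hq i).1) fun i _ => (hq i).2)

/-- A staircase of points `(x i, t ^ (2 * i + 2), t ^ (2 * k), …)` with `x i * t ^ (2 * i) ≤ B`
leaves no room for an empty open box of volume more than `B`. -/
lemma vol_le_of_staircase {e k : ℕ} {t B : ℝ} (ht : 0 ≤ t) (hB : t ^ (2 * k) ≤ B) {x : ℕ → ℝ}
    (hx : ∀ i < k, 0 ≤ x i) (hxB : ∀ i < k, x i * t ^ (2 * i) ≤ B) {q : Fin (e + 2) → ℝ}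
    (hq : ∀ i, 0 ≤ q i ∧ q i ≤ 1)
    (h_empty : ∀ i < k, ¬ inOpenBox q (planarPoint (x i) (t ^ (2 * i + 2)) (t ^ (2 * k)))) :
    vol q ≤ B := by
  by_contra! hvol
  have key : ∀ i ≤ k, q 1 ≤ t ^ (2 * i) := by
    intro i
    induction i with
    | zero => intro _; simpa using (hq 1).2
    | succ i ih =>
      intro hi
      by_contra! hlt
      refine h_empty i hi ((inOpenBox_planarPoint (hx i hi) (by positivity) (by positivity)).2
        ⟨?_, by simpa [mul_add] using hlt, fun l => ?_⟩)
      · by_contra! hle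
        have := mul_le_mul hle (ih (by omega)) (hq 1).1 (hx i hi)
        linarith [vol_le_mul hq, hxB i hi]
      · linarith [vol_le_apply hq l.succ.succ]
  linarith [key k le_rfl, vol_le_apply hq 1]

/-- Exponents of the first coordinates: a staircase of length `k`, shifted copies of its first `r`
points, and further points on the boundary of the cube. -/
def expFst (k r m : ℕ) : ℕ :=
  if m < k then 2 * (k - m) else if m < k + r then 2 * (k - (m - k)) - 1 else 0

/-- Exponents of the second coordinates. -/
def expSnd (k r m : ℕ) : ℕ :=
  if m < k then 2 * m + 2 else if m < k + r then 2 * (m - k) + 2 else m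

/-- The points of the construction. -/
def swapPoint (e k r : ℕ) (t : ℝ) (m : ℕ) : Fin (e + 2) → ℝ :=
  planarPoint (t ^ expFst k r m) (t ^ expSnd k r m) (t ^ (2 * k))

lemma swapPoint_injective {e k r : ℕ} {t : ℝ} (hrk : r ≤ k) (ht0 : 0 < t) (ht1 : t < 1) :
    Function.Injective (swapPoint e k r t) := by
  intro m m' h
  have h0 : expFst k r m = expFst k r m' :=
    pow_right_injective₀ ht0 ht1.ne (by simpa [swapPoint, planarPoint] using congrFun h 0)
  have h1 : expSnd k r m = expSnd k r m' :=
    pow_right_injective₀ ht0 ht1.ne (by simpa [swapPoint, planarPoint] using congrFun h 1)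
  unfold expFst at h0
  unfold expSnd at h1
  split_ifs at h0 h1 <;> omega

/-- A set of construction points that misses the `i`-th staircase point has large discrepancy. -/
lemma le_starDisc_of_notMem {e k r i : ℕ} {t : ℝ} (ht0 : 0 < t) (ht1 : t < 1)
    {S : Finset (Fin (e + 2) → ℝ)} (hS : ∀ p ∈ S, ∃ m, swapPoint e k r t m = p) (hi : i < k)
    (hiS : swapPoint e k r t i ∉ S) : t ^ (2 * k - 1) ≤ starDisc S := by
  have hq : ∀ l, 0 ≤ planarPoint (e := e) (t ^ (2 * (k - i) - 1)) (t ^ (2 * i)) 1 l ∧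
      planarPoint (e := e) (t ^ (2 * (k - i) - 1)) (t ^ (2 * i)) 1 l ≤ 1 :=
    forall_planarPoint (r := fun y => 0 ≤ y ∧ y ≤ 1)
      ⟨by positivity, pow_le_one₀ ht0.le ht1.le⟩ ⟨by positivity, pow_le_one₀ ht0.le ht1.le⟩
      ⟨zero_le_one, le_rfl⟩
  have h := vol_le_starDisc_of_empty hq (S := S) ?_
  · rwa [vol_planarPoint_one, ← pow_add,
      show 2 * (k - i) - 1 + 2 * i = 2 * k - 1 by omega] at h
  intro p hp hbox
  obtain ⟨m, rfl⟩ := hS p hp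
  have hmi : m ≠ i := by rintro rfl; exact hiS hp
  rw [swapPoint, inOpenBox_planarPoint (by positivity) (by positivity) (by positivity)] at hbox
  have h0 : 2 * (k - i) - 1 < expFst k r m :=
    (pow_lt_pow_iff_right_of_lt_one₀ ht0 ht1).1 (by simpa [planarPoint] using hbox.1)
  have h1 : 2 * i < expSnd k r m :=
    (pow_lt_pow_iff_right_of_lt_one₀ ht0 ht1).1 (by simpa [planarPoint] using hbox.2.1)
  unfold expFst at h0
  unfold expSnd at h1
  split_ifs at h0 h1 <;> omega

/-- A set consisting of one original or shifted staircase point for each index has small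
discrepancy. -/
lemma starDisc_image_le {e k r : ℕ} {t B : ℝ} {I : Finset ℕ} (ht0 : 0 < t) (ht1 : t < 1)
    (hk : 0 < k) (hrk : r ≤ k) (hI : ∀ m ∈ I, m < k + r)
    (hcard : (I.image (swapPoint e k r t)).card = k) (h_k : 1 - 1 / (k : ℝ) ≤ t ^ (2 * k))
    (h_vol : 1 - (t ^ (2 * k)) ^ (e + 2) ≤ t ^ (2 * k)) (hB : t ^ (2 * k) ≤ B)
    (h_stair : ∀ i < k, ∃ m ∈ I, expSnd k r m = 2 * i + 2 ∧ t ^ (expFst k r m + 2 * i) ≤ B) :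
    starDisc (I.image (swapPoint e k r t)) ≤ B := by
  refine starDisc_le (c := t ^ (2 * k)) (Finset.card_pos.1 (by omega)) (by positivity) ?_
    (by rw [hcard]; linarith) (by linarith) ?_
  · intro p hp
    obtain ⟨m, hm, rfl⟩ := Finset.mem_image.1 hp
    have hm' := hI m hm
    refine forall_planarPoint (pow_le_pow_of_le_one ht0.le ht1.le ?_)
      (pow_le_pow_of_le_one ht0.le ht1.le ?_) le_rfl
    · unfold expFst; split_ifs <;> omega
    · unfold expSnd; split_ifs <;> omega
  · intro q hq h_empty
    choose! m hmI hm2 hmB using h_stair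
    refine vol_le_of_staircase ht0.le hB (x := fun i => t ^ expFst k r (m i))
      (fun i _ => by positivity) (fun i hi => by rw [← pow_add]; exact hmB i hi) hq fun i hi => ?_
    have h := h_empty _ (Finset.mem_image_of_mem _ (hmI i hi))
    rwa [swapPoint, hm2 i hi] at h

lemma exists_ratio (k d : ℕ) (hk : 0 < k) : ∃ t : ℝ, 0 < t ∧ t < 1 ∧
    1 - 1 / (k : ℝ) ≤ t ^ (2 * k) ∧ 1 - (t ^ (2 * k)) ^ d ≤ t ^ (2 * k) := by
  have hk' : (0 : ℝ) < 1 / k := by positivity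
  have h0 : ∀ᶠ t : ℝ in nhds 1, 0 < t := lt_mem_nhds one_pos
  have h1 : ∀ᶠ t : ℝ in nhds 1, 1 - 1 / (k : ℝ) < t ^ (2 * k) :=
    ContinuousAt.eventually_lt (by fun_prop) (by fun_prop) (by simp [hk])
  have h2 : ∀ᶠ t : ℝ in nhds 1, 1 - (t ^ (2 * k)) ^ d < t ^ (2 * k) :=
    ContinuousAt.eventually_lt (by fun_prop) (by fun_prop) (by simp)
  obtain ⟨t, ⟨⟨ht0, ht1⟩, ht2⟩, ht⟩ :=
    ((((h0.and h1).and h2).filter_mono nhdsWithin_le_nhds).and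
      (self_mem_nhdsWithin (s := Set.Iio (1 : ℝ)))).exists
  exact ⟨t, ht0, ht, ht1.le, ht2.le⟩

/-- For every `d ≥ 2` and all `n, k, j` with `2 ≤ k ≤ n`, `j ≥ 1`, and either
(`n ≥ 2k` and `j < k`) or (`n < 2k` and `j < n - k`), there is an `n`-point set
`P ⊆ [0,1]^d` and a `k`-element subset `Q ⊆ P` that is a local minimum for `j`-swaps of
the star discrepancy subset selection problem with parameter `k` on `P` but not a
global minimum. -/
theorem exists_local_min_not_global (d n k j : ℕ) (hd : 2 ≤ d)
    (hk2 : 2 ≤ k) (hkn : k ≤ n) (hj1 : 1 ≤ j)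
    (hcase : (2 * k ≤ n ∧ j < k) ∨ (n < 2 * k ∧ j < n - k)) :
    ∃ P : Finset (Fin d → ℝ),
      (∀ p ∈ P, ∀ i, 0 ≤ p i ∧ p i ≤ 1) ∧ P.card = n ∧
      ∃ Q ⊆ P, Q.card = k ∧
        (∀ Q' ⊆ P, Q'.card = k → (Q \ Q').card ≤ j →
          starDisc Q ≤ starDisc Q') ∧
        ∃ Q' ⊆ P, Q'.card = k ∧ starDisc Q' < starDisc Q := by
  obtain ⟨e, rfl⟩ : ∃ e, d = e + 2 := ⟨d - 2, by omega⟩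
  obtain ⟨r, hrk, hrn, hjr⟩ : ∃ r, r ≤ k ∧ k + r ≤ n ∧ j < r :=
    ⟨min k (n - k), by omega, by omega, by omega⟩
  obtain ⟨t, ht0, ht1, h_k, h_vol⟩ := exists_ratio k (e + 2) (by omega)
  set f := swapPoint e k r t with hf
  have hinj : Function.Injective f := swapPoint_injective hrk ht0 ht1
  have hcard : ∀ I : Finset ℕ, (I.image f).card = I.card :=
    fun I => Finset.card_image_of_injective I hinj
  have hlt : t ^ (2 * k) < t ^ (2 * k - 1) := pow_lt_pow_right_of_lt_one₀ ht0 ht1 (by omega)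
  have hgood : starDisc ((Finset.range k).image f) ≤ t ^ (2 * k) := by
    refine starDisc_image_le ht0 ht1 (by omega) hrk (fun m hm => ?_) (by simp [← hf, hcard])
      h_k h_vol le_rfl fun i hi => ⟨i, by simpa using hi, ?_, ?_⟩
    · have := Finset.mem_range.1 hm
      omega
    · simp [expSnd, hi]
    · refine pow_le_pow_of_le_one ht0.le ht1.le ?_
      rw [expFst, if_pos hi]
      omega
  have hloc : starDisc ((Finset.Ico r (k + r)).image f) ≤ t ^ (2 * k - 1) := by
    refine starDisc_image_le ht0 ht1 (by omega) hrk (fun m hm => (Finset.mem_Ico.1 hm).2)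
      (by simp [← hf, hcard]) h_k h_vol hlt.le fun i hi =>
        ⟨if i < r then k + i else i, ?_, ?_, pow_le_pow_of_le_one ht0.le ht1.le ?_⟩
    · rw [Finset.mem_Ico]
      split_ifs <;> omega
    · unfold expSnd
      split_ifs <;> omega
    · unfold expFst
      split_ifs <;> omega
  refine ⟨(Finset.range n).image f, ?_, by simp [hcard], (Finset.Ico r (k + r)).image f, ?_,
    by simp [hcard], ?_, (Finset.range k).image f, ?_, by simp [hcard], ?_⟩
  · intro p hp
    obtain ⟨m, -, rfl⟩ := Finset.mem_image.1 hp
    have h01 : ∀ a : ℕ, 0 ≤ t ^ a ∧ t ^ a ≤ 1 :=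
      fun a => ⟨by positivity, pow_le_one₀ ht0.le ht1.le⟩
    exact forall_planarPoint (r := fun y => 0 ≤ y ∧ y ≤ 1) (h01 _) (h01 _) (h01 _)
  · refine Finset.image_subset_image fun m hm => ?_
    simp only [Finset.mem_Ico, Finset.mem_range] at hm ⊢
    omega
  · intro S hS hSk hSj
    refine hloc.trans ?_
    by_cases hsub : (Finset.range k).image f ⊆ S
    · exfalso
      obtain rfl := Finset.eq_of_subset_of_card_le hsub (by simp [hcard, hSk])
      have hle : (Finset.Ico k (k + r)).image f ⊆
          (Finset.Ico r (k + r)).image f \ (Finset.range k).image f := by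
        rw [← Finset.image_sdiff _ _ hinj]
        refine Finset.image_subset_image fun m hm => ?_
        simp only [Finset.mem_sdiff, Finset.mem_Ico, Finset.mem_range] at hm ⊢
        omega
      have := Finset.card_le_card hle
      rw [hcard, Nat.card_Ico] at this
      omega
    · obtain ⟨p, hp, hpS⟩ := Finset.not_subset.1 hsub
      obtain ⟨i, hi, rfl⟩ := Finset.mem_image.1 hp
      refine le_starDisc_of_notMem ht0 ht1 (fun p hp => ?_) (Finset.mem_range.1 hi) hpS
      obtain ⟨m, -, hm⟩ := Finset.mem_image.1 (hS hp)
      exact ⟨m, hm⟩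
  · exact Finset.image_subset_image (Finset.range_subset_range.2 hkn)
  · refine hgood.trans_lt (hlt.trans_le ?_)
    refine le_starDisc_of_notMem (r := r) (i := 0) ht0 ht1 (fun p hp => ?_) (by omega) fun h => ?_
    · obtain ⟨m, -, hm⟩ := Finset.mem_image.1 hp
      exact ⟨m, hm⟩
    · obtain ⟨m, hm, hm0⟩ := Finset.mem_image.1 h
      have := hinj hm0
      have := (Finset.mem_Ico.1 hm).1
      omega
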